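/- arXiv:2212.09063 — 10 statements merged into one kernel-verified Lean document; each statement's English description precedes it below -/
import Mathlib

section
/- Fix real numbers a, T, D with a ≠ 0, and let W(y) = D·y² − a·T·y + a². Fix y₀ ≥ 0. If y₁ ≤ 0 and y₁′ ≤ 0 are such that W(y) > 0 for every y ∈ [min(y₁, y₁′), y₀], and the interval integrals ∫_{y₁}^{y₀} (−y)/W(y) dy and ∫_{y₁′}^{y₀} (−y)/W(y) dy are equal, then y₁ = y₁′. (Uniqueness of the value of a Poincaré half-map determined by its integral characterization.) -/
open MeasureTheory in
/-- If `W` is continuous and positive on `[u, b]` and `u < v ≤ 0`, `v ≤ b`, then the integral of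
`(-y) / W y` up to `b` is strictly larger from `u` than from `v`. -/
theorem integral_neg_div_lt_of_lt {W : ℝ → ℝ} {u v b : ℝ} (huv : u < v) (hv : v ≤ 0)
    (hvb : v ≤ b) (hW : ContinuousOn W (Set.Icc u b)) (hpos : ∀ y ∈ Set.Icc u b, 0 < W y) :
    ∫ y in v..b, (-y) / W y < ∫ y in u..b, (-y) / W y := by
  have hcont : ContinuousOn (fun y => (-y) / W y) (Set.Icc u b) :=
    continuousOn_id.neg.div hW fun y hy => (hpos y hy).ne'
  have huv_int : IntervalIntegrable (fun y => (-y) / W y) volume u v :=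
    (hcont.mono (Set.Icc_subset_Icc_right hvb)).intervalIntegrable_of_Icc huv.le
  have hvb_int : IntervalIntegrable (fun y => (-y) / W y) volume v b :=
    (hcont.mono (Set.Icc_subset_Icc_left huv.le)).intervalIntegrable_of_Icc hvb
  have h_gap : 0 < ∫ y in u..v, (-y) / W y :=
    intervalIntegral.intervalIntegral_pos_of_pos_on huv_int
      (fun y hy => div_pos (by linarith [hy.2]) (hpos y ⟨hy.1.le, hy.2.le.trans hvb⟩)) huv
  rw [← intervalIntegral.integral_add_adjacent_intervals huv_int hvb_int]
  linarith

/-- Uniqueness of the value of a Poincaré half-map determined by its integral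
characterization: if `y₁, y₁' ≤ 0` both give the same interval integral of
`(-y)/W y` up to `y₀ ≥ 0`, where `W` is positive on the relevant interval,
then `y₁ = y₁'`. -/
theorem poincare_half_map_integral_uniqueness
    (a T D : ℝ) (ha : a ≠ 0)
    (W : ℝ → ℝ) (hW : ∀ y, W y = D * y ^ 2 - a * T * y + a ^ 2)
    (y₀ : ℝ) (hy₀ : 0 ≤ y₀)
    (y₁ y₁' : ℝ) (hy₁ : y₁ ≤ 0) (hy₁' : y₁' ≤ 0)
    (hpos : ∀ y ∈ Set.Icc (min y₁ y₁') y₀, 0 < W y)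
    (hint : ∫ y in y₁..y₀, (-y) / W y = ∫ y in y₁'..y₀, (-y) / W y) :
    y₁ = y₁' := by
  have hcont : Continuous W := by
    rw [funext hW]
    fun_prop
  rcases lt_trichotomy y₁ y₁' with h | h | h
  · rw [min_eq_left h.le] at hpos
    exact absurd hint
      (integral_neg_div_lt_of_lt h hy₁' (hy₁'.trans hy₀) hcont.continuousOn hpos).ne'
  · exact h
  · rw [min_eq_right h.le] at hpos
    exact absurd hint
      (integral_neg_div_lt_of_lt h hy₁ (hy₁.trans hy₀) hcont.continuousOn hpos).ne
end

section
/- Fix real numbers a, T, D with a ≠ 0, and let W(y) = D·y² − a·T·y + a². Let I ⊆ (0, ∞) be an open interval and let yL : I → ℝ be a differentiable function such that for every y₀ ∈ I one has yL(y₀) < 0, W(y) > 0 for all y ∈ [yL(y₀), y₀], and the integral ∫_{yL(y₀)}^{y₀} (−y)/W(y) dy is equal to one and the same constant q for all y₀ ∈ I. Then for every y₀ ∈ I the derivative satisfies yL′(y₀) = (y₀ · W(yL(y₀))) / (yL(y₀) · W(y₀)), and in particular yL′(y₀) < 0. -/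
/-- If `yL` is a differentiable function on an open interval `I ⊆ (0, ∞)` with
negative values, the quadratic `W` is positive on every segment `[yL y₀, y₀]`,
and the integral `∫_{yL y₀}^{y₀} (-y)/W y dy` is constant in `y₀`, then
`yL' y₀ = (y₀ · W (yL y₀)) / (yL y₀ · W y₀) < 0` on `I`. -/
theorem poincare_half_map_derivative
    (a T D : ℝ) (ha : a ≠ 0)
    (W : ℝ → ℝ) (hW : ∀ y, W y = D * y ^ 2 - a * T * y + a ^ 2)
    (lo hi : ℝ) (hlo : 0 ≤ lo)
    (yL : ℝ → ℝ)
    (hdiff : ∀ y₀ ∈ Set.Ioo lo hi, DifferentiableAt ℝ yL y₀)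
    (hneg : ∀ y₀ ∈ Set.Ioo lo hi, yL y₀ < 0)
    (hpos : ∀ y₀ ∈ Set.Ioo lo hi, ∀ y ∈ Set.Icc (yL y₀) y₀, 0 < W y)
    (q : ℝ)
    (hint : ∀ y₀ ∈ Set.Ioo lo hi, ∫ y in yL y₀..y₀, (-y) / W y = q) :
    ∀ y₀ ∈ Set.Ioo lo hi,
      deriv yL y₀ = (y₀ * W (yL y₀)) / (yL y₀ * W y₀) ∧ deriv yL y₀ < 0 := by
  intro y₀ hy
  have hy0 : 0 < y₀ := hlo.trans_lt hy.1
  have hL := hneg y₀ hy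
  have hle : yL y₀ ≤ y₀ := (hL.trans hy0).le
  have hWL : 0 < W (yL y₀) := hpos y₀ hy _ ⟨le_rfl, hle⟩
  have hWy : 0 < W y₀ := hpos y₀ hy _ ⟨hle, le_rfl⟩
  have hWc : Continuous W := by
    rw [funext hW]
    fun_prop
  have hmeas : Measurable fun y => (-y) / W y := measurable_neg.div hWc.measurable
  have hcont : ∀ y, W y ≠ 0 → ContinuousAt (fun y => (-y) / W y) y := fun y h =>
    continuousAt_id.neg.div hWc.continuousAt h
  have hii : IntervalIntegrable (fun y => (-y) / W y) MeasureTheory.volume (yL y₀) y₀ := by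
    apply ContinuousOn.intervalIntegrable
    rw [Set.uIcc_of_le hle]
    exact fun y h => (hcont y (hpos y₀ hy y h).ne').continuousWithinAt
  have hF := intervalIntegral.integral_hasFDerivAt hii
    hmeas.stronglyMeasurable.stronglyMeasurableAtFilter
    hmeas.stronglyMeasurable.stronglyMeasurableAtFilter
    (hcont _ hWL.ne') (hcont _ hWy.ne')
  have hG := HasFDerivAt.comp_hasDerivAt (f := fun y => (yL y, y)) y₀ hF
    ((hdiff y₀ hy).hasDerivAt.prodMk (hasDerivAt_id y₀))
  have hconst := (hasDerivAt_const y₀ q).congr_of_eventuallyEq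
    (Filter.eventually_of_mem (isOpen_Ioo.mem_nhds hy) hint)
  have key := hG.unique hconst
  simp at key
  have hd : deriv yL y₀ = (y₀ * W (yL y₀)) / (yL y₀ * W y₀) := by
    have := hWL.ne'
    have := hWy.ne'
    have := hL.ne
    field_simp at key ⊢
    linarith
  refine ⟨hd, ?_⟩
  rw [hd]
  exact div_neg_of_pos_of_neg (mul_pos hy0 hWL) (mul_neg_of_neg_of_pos hL hWy)
end

section
/- Fix real numbers a, T, D with a > 0, and let W(y) = D·y² − a·T·y + a². Suppose y₁ < 0 < y₀, W(y) > 0 for all y ∈ [y₁, y₀], and ∫_{y₁}^{y₀} (−y)/W(y) dy = 0. Then sign(y₀ + y₁) = −sign(T); that is, y₀ + y₁ > 0 if T < 0, y₀ + y₁ = 0 if T = 0, and y₀ + y₁ < 0 if T > 0. -/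
/-- If `T ≤ 0` and `y₀ + y₁ ≤ 0`, then the vanishing of the integral forces both to be zero. -/
theorem eq_zero_of_integral_eq_zero_of_nonpos
    (a T D : ℝ) (ha : 0 < a)
    (W : ℝ → ℝ) (hW : ∀ y, W y = D * y ^ 2 - a * T * y + a ^ 2)
    (y₁ y₀ : ℝ) (hy₀ : 0 < y₀)
    (hpos : ∀ y ∈ Set.Icc y₁ y₀, 0 < W y)
    (hint : ∫ y in y₁..y₀, (-y) / W y = 0)
    (hT : T ≤ 0) (hsum : y₀ + y₁ ≤ 0) : y₀ + y₁ = 0 ∧ T = 0 := by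
  have hWc : Continuous W := by
    rw [funext hW]
    fun_prop
  have hcont : ContinuousOn (fun y => (-y) / W y) (Set.Icc y₁ y₀) :=
    continuousOn_id.neg.div hWc.continuousOn fun y hy => (hpos y hy).ne'
  have hii : ∀ c d, c ∈ Set.Icc y₁ y₀ → d ∈ Set.Icc y₁ y₀ →
      IntervalIntegrable (fun y => (-y) / W y) MeasureTheory.volume c d := fun c d hc hd =>
    (hcont.mono (Set.uIcc_subset_Icc hc hd)).intervalIntegrable
  have m₁ : y₁ ∈ Set.Icc y₁ y₀ := ⟨le_rfl, by linarith⟩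
  have m₂ : -y₀ ∈ Set.Icc y₁ y₀ := ⟨by linarith, by linarith⟩
  have m₃ : (0 : ℝ) ∈ Set.Icc y₁ y₀ := ⟨by linarith, by linarith⟩
  have m₄ : y₀ ∈ Set.Icc y₁ y₀ := ⟨by linarith, le_rfl⟩
  have hrefl : IntervalIntegrable (fun y => (-(-y)) / W (-y)) MeasureTheory.volume 0 y₀ := by
    apply ContinuousOn.intervalIntegrable
    rw [Set.uIcc_of_le hy₀.le]
    exact hcont.comp continuousOn_neg fun y hy =>
      ⟨by linarith [hy.2], by linarith [hy.1]⟩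
  have hsplit : (∫ y in y₁..(-y₀), (-y) / W y) +
      ∫ y in (0 : ℝ)..y₀, ((-(-y)) / W (-y) + (-y) / W y) = 0 := by
    rw [intervalIntegral.integral_add hrefl (hii _ _ m₃ m₄),
      intervalIntegral.integral_comp_neg (fun y => (-y) / W y), neg_zero, ← add_assoc,
      intervalIntegral.integral_add_adjacent_intervals (hii _ _ m₁ m₂) (hii _ _ m₂ m₃),
      intervalIntegral.integral_add_adjacent_intervals (hii _ _ m₁ m₃) (hii _ _ m₃ m₄), hint]
  have hfold : ∀ y ∈ Set.Icc 0 y₀, (-(-y)) / W (-y) + (-y) / W y =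
      y * (-(2 * a * T * y)) / (W (-y) * W y) := by
    intro y hy
    have h₁ := (hpos y ⟨by linarith [hy.1], hy.2⟩).ne'
    have h₂ := (hpos (-y) ⟨by linarith [hy.2], by linarith [hy.1]⟩).ne'
    have h₃ : -(2 * a * T * y) = W y - W (-y) := by rw [hW, hW]; ring
    rw [h₃]
    field_simp
    ring
  have hden : ∀ y ∈ Set.Icc 0 y₀, 0 < W (-y) * W y := fun y hy =>
    mul_pos (hpos (-y) ⟨by linarith [hy.2], by linarith [hy.1]⟩)
      (hpos y ⟨by linarith [hy.1], hy.2⟩)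
  have hA : 0 ≤ ∫ y in y₁..(-y₀), (-y) / W y :=
    intervalIntegral.integral_nonneg (by linarith) fun y hy =>
      div_nonneg (by linarith [hy.2]) (hpos y ⟨hy.1, by linarith [hy.2]⟩).le
  have hB : 0 ≤ ∫ y in (0 : ℝ)..y₀, ((-(-y)) / W (-y) + (-y) / W y) := by
    refine intervalIntegral.integral_nonneg hy₀.le fun y hy => ?_
    rw [hfold y hy]
    refine div_nonneg (mul_nonneg hy.1 ?_) (hden y hy).le
    have := mul_nonneg (mul_nonneg ha.le (neg_nonneg.2 hT)) hy.1
    linarith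
  constructor
  · by_contra hne
    have hlt : y₁ < -y₀ := by
      have := lt_of_le_of_ne hsum hne
      linarith
    have : 0 < ∫ y in y₁..(-y₀), (-y) / W y :=
      intervalIntegral.intervalIntegral_pos_of_pos_on (hii _ _ m₁ m₂)
        (fun y hy => div_pos (by linarith [hy.2]) (hpos y ⟨hy.1.le, by linarith [hy.2]⟩)) hlt
    linarith
  · by_contra hne
    have hlt : T < 0 := lt_of_le_of_ne hT hne
    have : 0 < ∫ y in (0 : ℝ)..y₀, ((-(-y)) / W (-y) + (-y) / W y) := by
      refine intervalIntegral.intervalIntegral_pos_of_pos_on (hrefl.add (hii _ _ m₃ m₄))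
        (fun y hy => ?_) hy₀
      have hy' := Set.Ioo_subset_Icc_self hy
      rw [hfold y hy']
      refine div_pos (mul_pos hy.1 ?_) (hden y hy')
      have := mul_pos (mul_pos ha (neg_pos.2 hlt)) hy.1
      linarith
    linarith

/-- If `0 ≤ T` and `0 ≤ y₀ + y₁`, then the vanishing of the integral forces both to be zero. -/
theorem eq_zero_of_integral_eq_zero_of_nonneg
    (a T D : ℝ) (ha : 0 < a)
    (W : ℝ → ℝ) (hW : ∀ y, W y = D * y ^ 2 - a * T * y + a ^ 2)
    (y₁ y₀ : ℝ) (hy₁ : y₁ < 0)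
    (hpos : ∀ y ∈ Set.Icc y₁ y₀, 0 < W y)
    (hint : ∫ y in y₁..y₀, (-y) / W y = 0)
    (hT : 0 ≤ T) (hsum : 0 ≤ y₀ + y₁) : y₀ + y₁ = 0 ∧ T = 0 := by
  have hint' : ∫ y in (-y₀)..(-y₁), (-y) / W (-y) = 0 := by
    rw [intervalIntegral.integral_comp_neg (fun y => y / W y), neg_neg, neg_neg]
    simpa only [neg_div, intervalIntegral.integral_neg, neg_eq_zero] using hint
  obtain ⟨h₁, h₂⟩ := eq_zero_of_integral_eq_zero_of_nonpos a (-T) D ha (fun y => W (-y))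
    (fun y => by rw [hW]; ring) (-y₀) (-y₁) (by linarith)
    (fun y hy => hpos (-y) ⟨by linarith [hy.2], by linarith [hy.1]⟩) hint'
    (by linarith) (by linarith)
  exact ⟨by linarith, by linarith⟩

/-- For `a > 0`, if `y₁ < 0 < y₀`, `W > 0` on `[y₁, y₀]`, and
`∫_{y₁}^{y₀} (-y)/W y dy = 0`, then `sign (y₀ + y₁) = - sign T`. -/
theorem sign_sum_of_integral_eq_zero
    (a T D : ℝ) (ha : 0 < a)
    (W : ℝ → ℝ) (hW : ∀ y, W y = D * y ^ 2 - a * T * y + a ^ 2)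
    (y₁ y₀ : ℝ) (hy₁ : y₁ < 0) (hy₀ : 0 < y₀)
    (hpos : ∀ y ∈ Set.Icc y₁ y₀, 0 < W y)
    (hint : ∫ y in y₁..y₀, (-y) / W y = 0) :
    (T < 0 → 0 < y₀ + y₁) ∧ (T = 0 → y₀ + y₁ = 0) ∧ (0 < T → y₀ + y₁ < 0) := by
  have hnonpos := eq_zero_of_integral_eq_zero_of_nonpos a T D ha W hW y₁ y₀ hy₀ hpos hint
  have hnonneg := eq_zero_of_integral_eq_zero_of_nonneg a T D ha W hW y₁ y₀ hy₁ hpos hint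
  refine ⟨fun hT => ?_, fun hT => ?_, fun hT => ?_⟩
  · by_contra! h
    exact hT.ne (hnonpos hT.le h).2
  · exact (le_total (y₀ + y₁) 0).elim (fun h => (hnonpos hT.le h).1) fun h => (hnonneg hT.ge h).1
  · by_contra! h
    exact hT.ne' (hnonneg hT.le h).2
end

section
/- Fix real numbers a, T, D with a < 0 and 4D − T² > 0, and let W(y) = D·y² − a·T·y + a². Suppose y₁ < 0 < y₀, W(y) > 0 for all y ∈ [y₁, y₀], and ∫_{y₁}^{y₀} (−y)/W(y) dy = 2πT/(D·√(4D − T²)). Then sign(y₀ + y₁) = −sign(T); that is, y₀ + y₁ > 0 if T < 0, y₀ + y₁ = 0 if T = 0, and y₀ + y₁ < 0 if T > 0. -/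
open Real

/-- An antiderivative of `-y / (D y² - a T y + a²)` when the quadratic has no real root. -/
theorem hasDerivAt_log_add_arctan {a T D : ℝ} (ha : a < 0) (hdisc : 0 < 4 * D - T ^ 2) (y : ℝ) :
    HasDerivAt (fun y => -(1 / (2 * D)) * log (D * y ^ 2 - a * T * y + a ^ 2) +
        T / (D * √(4 * D - T ^ 2)) * arctan ((2 * D * y - a * T) / (-a * √(4 * D - T ^ 2))))
      (-y / (D * y ^ 2 - a * T * y + a ^ 2)) y := by
  have hD : 0 < D := by nlinarith [sq_nonneg T]
  have hs : √(4 * D - T ^ 2) ^ 2 = 4 * D - T ^ 2 := sq_sqrt hdisc.le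
  have hω : 0 < √(4 * D - T ^ 2) := sqrt_pos.2 hdisc
  set ω := √(4 * D - T ^ 2)
  have hW : 0 < D * y ^ 2 - a * T * y + a ^ 2 := by
    have : 0 < a ^ 2 * (4 * D - T ^ 2) := mul_pos (sq_pos_of_neg ha) hdisc
    have : 0 < 4 * D * (D * y ^ 2 - a * T * y + a ^ 2) := by
      nlinarith [sq_nonneg (2 * D * y - a * T)]
    exact pos_of_mul_pos_right this (by positivity)
  have hquad : HasDerivAt (fun y => D * y ^ 2 - a * T * y + a ^ 2) (2 * D * y - a * T) y := by
    have h := (((hasDerivAt_pow 2 y).const_mul D).sub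
      ((hasDerivAt_id y).const_mul (a * T))).add_const (a ^ 2)
    refine h.congr_deriv ?_
    push_cast
    ring
  have hlin : HasDerivAt (fun y => (2 * D * y - a * T) / (-a * ω)) (2 * D / (-a * ω)) y := by
    have h := (((hasDerivAt_id y).const_mul (2 * D)).sub_const (a * T)).div_const (-a * ω)
    simpa using h
  have h := ((hquad.log hW.ne').const_mul (-(1 / (2 * D)))).add
    (hlin.arctan.const_mul (T / (D * ω)))
  refine h.congr_deriv ?_
  have ha' : a ≠ 0 := ha.ne
  have hsum : 1 + ((2 * D * y - a * T) / (-a * ω)) ^ 2 =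
      4 * D * (D * y ^ 2 - a * T * y + a ^ 2) / (a ^ 2 * ω ^ 2) := by
    field_simp
    rw [hs]
    ring
  rw [hsum]
  generalize hq : D * y ^ 2 - a * T * y + a ^ 2 = q at hW
  have := hW.ne'
  field_simp
  ring

/-- For `a < 0` and `4D - T² > 0`, if `y₁ < 0 < y₀`, `W > 0` on `[y₁, y₀]`, and
`∫_{y₁}^{y₀} (-y)/W y dy = 2πT/(D√(4D - T²))`, then `sign (y₀ + y₁) = - sign T`. -/
theorem sign_sum_of_integral_eq_qL_neg
    (a T D : ℝ) (ha : a < 0) (hdisc : 0 < 4 * D - T ^ 2)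
    (W : ℝ → ℝ) (hW : ∀ y, W y = D * y ^ 2 - a * T * y + a ^ 2)
    (y₁ y₀ : ℝ) (hy₁ : y₁ < 0) (hy₀ : 0 < y₀)
    (hpos : ∀ y ∈ Set.Icc y₁ y₀, 0 < W y)
    (hint : ∫ y in y₁..y₀, (-y) / W y =
      2 * π * T / (D * Real.sqrt (4 * D - T ^ 2))) :
    (T < 0 → 0 < y₀ + y₁) ∧ (T = 0 → y₀ + y₁ = 0) ∧ (0 < T → y₀ + y₁ < 0) := by
  have hD : 0 < D := by nlinarith [sq_nonneg T]
  have hω : 0 < √(4 * D - T ^ 2) := sqrt_pos.2 hdisc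
  have hle : y₁ ≤ y₀ := by linarith
  have hW₁ : 0 < W y₁ := hpos y₁ ⟨le_rfl, hle⟩
  have hW₀ : 0 < W y₀ := hpos y₀ ⟨hle, le_rfl⟩
  have hint' : IntervalIntegrable (fun y => -y / W y) MeasureTheory.volume y₁ y₀ := by
    refine ContinuousOn.intervalIntegrable ?_
    rw [Set.uIcc_of_le hle]
    refine continuousOn_neg.div ?_ fun y hy => (hpos y hy).ne'
    rw [funext hW]
    fun_prop
  have hftc := intervalIntegral.integral_eq_sub_of_hasDerivAt
    (fun y _ => hW y ▸ hasDerivAt_log_add_arctan ha hdisc y) hint'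
  rw [hint, ← hW, ← hW] at hftc
  set ω := √(4 * D - T ^ 2)
  have hθ₀ := arctan_lt_pi_div_two ((2 * D * y₀ - a * T) / (-a * ω))
  have hθ₁ := neg_pi_div_two_lt_arctan ((2 * D * y₁ - a * T) / (-a * ω))
  set θ₀ := arctan ((2 * D * y₀ - a * T) / (-a * ω))
  set θ₁ := arctan ((2 * D * y₁ - a * T) / (-a * ω))
  have hlog : log (W y₁) - log (W y₀) = 2 / ω * (2 * π - (θ₀ - θ₁)) * T := by
    field_simp at hftc ⊢
    linarith
  have hc : 0 < 2 / ω * (2 * π - (θ₀ - θ₁)) :=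
    mul_pos (by positivity) (by linarith [pi_pos])
  have hdiff : W y₀ - W y₁ = (y₀ - y₁) * (D * (y₀ + y₁) - a * T) := by
    rw [hW, hW]
    ring
  have hlen : 0 < y₀ - y₁ := by linarith
  refine ⟨fun hT => ?_, fun hT => ?_, fun hT => ?_⟩
  · have hlt : W y₁ < W y₀ := (log_lt_log_iff hW₁ hW₀).1 (by nlinarith)
    have : 0 < D * (y₀ + y₁) - a * T := pos_of_mul_pos_right (by linarith) hlen.le
    exact pos_of_mul_pos_right (by nlinarith : 0 < D * (y₀ + y₁)) hD.le
  · have heq : W y₁ = W y₀ :=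
      log_injOn_pos hW₁ hW₀ (by rw [hT, mul_zero] at hlog; linarith)
    rw [heq, sub_self, hT, mul_zero, sub_zero] at hdiff
    simpa [hlen.ne', hD.ne'] using hdiff.symm
  · have hlt : W y₀ < W y₁ := (log_lt_log_iff hW₀ hW₁).1 (by nlinarith)
    have : D * (y₀ + y₁) - a * T < 0 := by nlinarith
    nlinarith
end

section
/- Fix real numbers a, T, D with a > 0 and 4D − T² > 0, and let W(y) = D·y² − a·T·y + a². Suppose y₁ < 0 < y₀, W(y) > 0 for all y ∈ [y₁, y₀], and ∫_{y₁}^{y₀} (−y)/W(y) dy = −2πT/(D·√(4D − T²)). Then sign(y₀ + y₁) = sign(T); that is, y₀ + y₁ > 0 if T > 0, y₀ + y₁ = 0 if T = 0, and y₀ + y₁ < 0 if T < 0. -/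
open Real

/-- An antiderivative of `-y / (D y² - a T y + a²)` when the quadratic has no real root. -/
lemma hasDerivAt_log_add_arctan_quadratic {a T D s : ℝ} (ha : a ≠ 0) (hD : D ≠ 0) (hs : s ≠ 0)
    (hsq : s ^ 2 = 4 * D - T ^ 2) {y : ℝ} (hy : D * y ^ 2 - a * T * y + a ^ 2 ≠ 0) :
    HasDerivAt (fun x => -(Real.log (D * x ^ 2 - a * T * x + a ^ 2) / (2 * D)) -
        T / (D * s) * Real.arctan ((2 * D * x - a * T) / (a * s)))
      (-y / (D * y ^ 2 - a * T * y + a ^ 2)) y := by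
  have hquad : HasDerivAt (fun x : ℝ => D * x ^ 2 - a * T * x + a ^ 2) (2 * D * y - a * T) y := by
    refine (((((hasDerivAt_id' y).fun_pow 2).const_mul D).fun_sub
      ((hasDerivAt_id' y).const_mul (a * T))).add_const (a ^ 2)).congr_deriv ?_
    push_cast
    ring
  have hlin : HasDerivAt (fun x : ℝ => (2 * D * x - a * T) / (a * s)) (2 * D / (a * s)) y := by
    simpa using (((hasDerivAt_id' y).const_mul (2 * D)).sub_const (a * T)).div_const (a * s)
  have hsum : 1 + ((2 * D * y - a * T) / (a * s)) ^ 2 =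
      4 * D * (D * y ^ 2 - a * T * y + a ^ 2) / (a * s) ^ 2 := by
    field_simp
    rw [hsq]
    ring
  refine (((hquad.log hy).div_const (2 * D)).fun_neg.fun_sub
    (hlin.arctan.const_mul (T / (D * s)))).congr_deriv ?_
  rw [hsum]
  field_simp
  ring

/-- For `a > 0` and `4D - T² > 0`, if `y₁ < 0 < y₀`, `W > 0` on `[y₁, y₀]`, and
`∫_{y₁}^{y₀} (-y)/W y dy = -2πT/(D√(4D - T²))`, then `sign (y₀ + y₁) = sign T`. -/
theorem sign_sum_of_integral_eq_qR_pos
    (a T D : ℝ) (ha : 0 < a) (hdisc : 0 < 4 * D - T ^ 2)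
    (W : ℝ → ℝ) (hW : ∀ y, W y = D * y ^ 2 - a * T * y + a ^ 2)
    (y₁ y₀ : ℝ) (hy₁ : y₁ < 0) (hy₀ : 0 < y₀)
    (hpos : ∀ y ∈ Set.Icc y₁ y₀, 0 < W y)
    (hint : ∫ y in y₁..y₀, (-y) / W y =
      -(2 * π * T) / (D * Real.sqrt (4 * D - T ^ 2))) :
    (0 < T → 0 < y₀ + y₁) ∧ (T = 0 → y₀ + y₁ = 0) ∧ (T < 0 → y₀ + y₁ < 0) := by
  have hD : 0 < D := by nlinarith [sq_nonneg T]
  obtain rfl : W = fun y => D * y ^ 2 - a * T * y + a ^ 2 := funext hW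
  have hs : 0 < √(4 * D - T ^ 2) := Real.sqrt_pos.2 hdisc
  have hsq := Real.sq_sqrt hdisc.le
  set s := √(4 * D - T ^ 2)
  have hlt : y₁ < y₀ := hy₁.trans hy₀
  have hpos₀ : 0 < D * y₀ ^ 2 - a * T * y₀ + a ^ 2 := hpos y₀ ⟨hlt.le, le_rfl⟩
  have hpos₁ : 0 < D * y₁ ^ 2 - a * T * y₁ + a ^ 2 := hpos y₁ ⟨le_rfl, hlt.le⟩
  rw [intervalIntegral.integral_eq_sub_of_hasDerivAt
    (fun y hy => hasDerivAt_log_add_arctan_quadratic ha.ne' hD.ne' hs.ne' hsq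
      (hpos y (Set.uIcc_of_le hlt.le ▸ hy)).ne')
    (ContinuousOn.intervalIntegrable (ContinuousOn.div (by fun_prop) (by fun_prop)
      fun y hy => (hpos y (Set.uIcc_of_le hlt.le ▸ hy)).ne'))] at hint
  set θ₀ := Real.arctan ((2 * D * y₀ - a * T) / (a * s))
  set θ₁ := Real.arctan ((2 * D * y₁ - a * T) / (a * s))
  have hθ : 0 < 2 * π - (θ₀ - θ₁) := by
    linarith [Real.arctan_lt_pi_div_two ((2 * D * y₀ - a * T) / (a * s)),
      Real.neg_pi_div_two_lt_arctan ((2 * D * y₁ - a * T) / (a * s)), Real.pi_pos]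
  have hlog : Real.log (D * y₀ ^ 2 - a * T * y₀ + a ^ 2) -
      Real.log (D * y₁ ^ 2 - a * T * y₁ + a ^ 2) = T * (2 * (2 * π - (θ₀ - θ₁)) / s) := by
    field_simp at hint ⊢
    linarith
  have hfac : 0 < 2 * (2 * π - (θ₀ - θ₁)) / s := by positivity
  have hdiff : (D * y₀ ^ 2 - a * T * y₀ + a ^ 2) - (D * y₁ ^ 2 - a * T * y₁ + a ^ 2) =
      (y₀ - y₁) * (D * (y₀ + y₁) - a * T) := by ring
  have hsub : 0 < y₀ - y₁ := sub_pos.2 hlt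
  refine ⟨fun hT => ?_, fun hT => ?_, fun hT => ?_⟩
  · have hW_lt := (Real.log_lt_log_iff hpos₁ hpos₀).1 (by linarith [mul_pos hT hfac])
    have := pos_of_mul_pos_right (hdiff ▸ sub_pos.2 hW_lt) hsub.le
    exact pos_of_mul_pos_right (by linarith [mul_pos ha hT] : 0 < D * (y₀ + y₁)) hD.le
  · rw [hT, zero_mul, sub_eq_zero, ← hT] at hlog
    have hW_eq := Real.log_injOn_pos hpos₀ hpos₁ hlog
    rw [hW_eq, sub_self, hT, mul_zero, sub_zero] at hdiff
    simpa [hsub.ne', hD.ne'] using hdiff.symm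
  · have hW_lt := (Real.log_lt_log_iff hpos₀ hpos₁).1
      (by linarith [mul_neg_of_neg_of_pos hT hfac])
    have := neg_of_mul_neg_right (hdiff ▸ sub_neg.2 hW_lt) hsub.le
    exact neg_of_mul_neg_right
      (by linarith [mul_neg_of_pos_of_neg ha hT] : D * (y₀ + y₁) < 0) hD.le
end

section
/- Fix real numbers a, T, D with a ≠ 0, let W(y) = D·y² − a·T·y + a², and let ŷ₁ < 0. Let ε > 0 and let yR : [0, ε) → ℝ be a function that is continuous at 0 with yR(0) = ŷ₁ and differentiable on (0, ε), such that for every y₀ ∈ [0, ε) one has yR(y₀) < 0 and W(y) > 0 for all y ∈ [yR(y₀), y₀], and such that the integral ∫_{yR(y₀)}^{y₀} (−y)/W(y) dy is equal to one and the same constant for all y₀ ∈ [0, ε). Then the limit as y₀ → 0⁺ of (yR(y₀) − ŷ₁)/y₀² exists and equals W(ŷ₁)/(2·a²·ŷ₁). In particular, the one-sided derivative of yR at 0 is zero. -/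
open MeasureTheory Set Filter Topology

/-- Second-order Taylor behavior at the origin of a Poincaré half-map `yR`
with `yR 0 = yhat₁ < 0`: the limit of `(yR y₀ - yhat₁)/y₀²` as `y₀ → 0⁺` is
`W yhat₁ / (2 a² yhat₁)`; in particular the one-sided derivative of `yR` at `0`
vanishes. -/
theorem poincare_half_map_taylor_at_zero
    (a T D : ℝ) (ha : a ≠ 0)
    (W : ℝ → ℝ) (hW : ∀ y, W y = D * y ^ 2 - a * T * y + a ^ 2)
    (yhat₁ : ℝ) (hyhat₁ : yhat₁ < 0)
    (ε : ℝ) (hε : 0 < ε)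
    (yR : ℝ → ℝ)
    (hcont : ContinuousWithinAt yR (Set.Ici 0) 0)
    (h0 : yR 0 = yhat₁)
    (hdiff : ∀ y₀ ∈ Set.Ioo (0 : ℝ) ε, DifferentiableAt ℝ yR y₀)
    (hneg : ∀ y₀ ∈ Set.Ico (0 : ℝ) ε, yR y₀ < 0)
    (hpos : ∀ y₀ ∈ Set.Ico (0 : ℝ) ε, ∀ y ∈ Set.Icc (yR y₀) y₀, 0 < W y)
    (q : ℝ)
    (hint : ∀ y₀ ∈ Set.Ico (0 : ℝ) ε, ∫ y in yR y₀..y₀, (-y) / W y = q) :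
    Filter.Tendsto (fun y₀ => (yR y₀ - yhat₁) / y₀ ^ 2)
      (nhdsWithin 0 (Set.Ioi 0)) (nhds (W yhat₁ / (2 * a ^ 2 * yhat₁))) ∧
    Filter.Tendsto (fun y₀ => (yR y₀ - yR 0) / y₀)
      (nhdsWithin 0 (Set.Ioi 0)) (nhds 0) := by
  set g : ℝ → ℝ := fun y => (-y) / W y with hg
  have hWcont : Continuous W := by
    rw [show W = fun y => D * y ^ 2 - a * T * y + a ^ 2 from funext hW]
    fun_prop
  have hgmeas : StronglyMeasurable g :=
    (measurable_id.neg.div hWcont.measurable).stronglyMeasurable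
  have hgcont : ∀ y, 0 < W y → ContinuousAt g y := fun y hy =>
    continuousAt_id.neg.div hWcont.continuousAt hy.ne'
  have hW0 : W 0 = a ^ 2 := by simp [hW]
  have hWhat : 0 < W yhat₁ :=
    hpos 0 ⟨le_rfl, hε⟩ yhat₁ ⟨h0.le, hyhat₁.le⟩
  have hderiv : ∀ b c, 0 < W c → IntervalIntegrable g volume b c →
      HasDerivAt (fun x => ∫ y in b..x, g y) (g c) c := fun b c hc hbc =>
    intervalIntegral.integral_hasDerivAt_right hbc
      hgmeas.stronglyMeasurableAtFilter (hgcont c hc)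
  have hintegrable : ∀ y₀ ∈ Ico (0 : ℝ) ε, ∀ b ∈ Icc (yR y₀) y₀, ∀ c ∈ Icc (yR y₀) y₀,
      IntervalIntegrable g volume b c := fun y₀ hy₀ b hb c hc =>
    ContinuousOn.intervalIntegrable fun y hy =>
      (hgcont y (hpos y₀ hy₀ y (uIcc_subset_Icc hb hc hy))).continuousWithinAt
  have hzero_mem : ∀ y₀ ∈ Ico (0 : ℝ) ε, (0 : ℝ) ∈ Icc (yR y₀) y₀ := fun y₀ hy₀ =>
    ⟨(hneg y₀ hy₀).le, hy₀.1⟩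
  have hself_mem : ∀ y₀ ∈ Ico (0 : ℝ) ε, y₀ ∈ Icc (yR y₀) y₀ := fun y₀ hy₀ =>
    ⟨(hneg y₀ hy₀).le.trans hy₀.1, le_rfl⟩
  have hHderiv : ∀ y₀ ∈ Ico (0 : ℝ) ε,
      HasDerivAt (fun x => ∫ y in (0 : ℝ)..x, g y) (g y₀) y₀ := fun y₀ hy₀ =>
    hderiv 0 y₀ (hpos y₀ hy₀ y₀ (hself_mem y₀ hy₀))
      (hintegrable y₀ hy₀ 0 (hzero_mem y₀ hy₀) y₀ (hself_mem y₀ hy₀))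
  have hIoo : ∀ᶠ y₀ in 𝓝[>] (0 : ℝ), y₀ ∈ Ioo 0 ε := Ioo_mem_nhdsGT hε
  have hHlim : Tendsto (fun y₀ => (∫ y in (0 : ℝ)..y₀, g y) / y₀ ^ 2) (𝓝[>] 0)
      (𝓝 (-1 / (2 * a ^ 2))) := by
    refine HasDerivAt.lhopital_zero_nhdsGT (f' := g) (g' := fun y => 2 * y) ?_ ?_ ?_ ?_ ?_ ?_
    · filter_upwards [hIoo] with y hy using hHderiv y (Ioo_subset_Ico_self hy)
    · exact Eventually.of_forall fun y => by simpa using hasDerivAt_pow 2 y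
    · filter_upwards [hIoo] with y hy using (mul_pos two_pos hy.1).ne'
    · simpa using (hHderiv 0 ⟨le_rfl, hε⟩).continuousAt.tendsto.mono_left nhdsWithin_le_nhds
    · have : Tendsto (fun y : ℝ => y ^ 2) (𝓝 0) (𝓝 (0 ^ 2)) := (continuous_pow 2).tendsto 0
      simpa using this.mono_left nhdsWithin_le_nhds
    · have hlim : Tendsto (fun y => -1 / (2 * W y)) (𝓝[>] 0) (𝓝 (-1 / (2 * a ^ 2))) := by
        rw [← hW0]
        refine Tendsto.mono_left (Tendsto.div tendsto_const_nhds
          ((hWcont.tendsto 0).const_mul 2) ?_) nhdsWithin_le_nhds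
        rw [hW0]
        positivity
      refine hlim.congr' ?_
      filter_upwards [hIoo] with y hy
      have hy₀ := Ioo_subset_Ico_self hy
      have := (hpos y hy₀ y (hself_mem y hy₀)).ne'
      have := hy.1.ne'
      simp only [hg]
      field_simp
  set G : ℝ → ℝ := fun x => ∫ y in yhat₁..x, g y with hG
  have hGderiv : HasDerivAt G (g yhat₁) yhat₁ :=
    hderiv yhat₁ yhat₁ hWhat IntervalIntegrable.refl
  have hghat : g yhat₁ ≠ 0 := div_ne_zero (neg_ne_zero.mpr hyhat₁.ne) hWhat.ne'
  have hyRlim : Tendsto yR (𝓝[>] 0) (𝓝 yhat₁) := by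
    have := hcont.tendsto.mono_left (nhdsWithin_mono 0 Ioi_subset_Ici_self)
    rwa [h0] at this
  have hslope : Tendsto (fun y₀ => dslope G yhat₁ (yR y₀)) (𝓝[>] 0) (𝓝 (g yhat₁)) := by
    have := (continuousAt_dslope_same.mpr hGderiv.differentiableAt).tendsto
    rw [dslope_same, hGderiv.deriv] at this
    exact this.comp hyRlim
  have hGH : ∀ y₀ ∈ Ico (0 : ℝ) ε,
      (yR y₀ - yhat₁) * dslope G yhat₁ (yR y₀) = ∫ y in (0 : ℝ)..y₀, g y := by
    intro y₀ hy₀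
    have hslope_eq : (yR y₀ - yhat₁) * dslope G yhat₁ (yR y₀) = G (yR y₀) := by
      simpa [hG] using sub_smul_dslope G yhat₁ (yR y₀)
    have h0mem : (0 : ℝ) ∈ Ico 0 ε := ⟨le_rfl, hε⟩
    have hleft : IntervalIntegrable g volume yhat₁ 0 :=
      hintegrable 0 h0mem yhat₁ ⟨h0.le, hyhat₁.le⟩ 0 (hzero_mem 0 h0mem)
    have hright := hintegrable y₀ hy₀ 0 (hzero_mem y₀ hy₀) y₀ (hself_mem y₀ hy₀)
    have hmain := hintegrable y₀ hy₀ (yR y₀) ⟨le_rfl, (hself_mem y₀ hy₀).1⟩ y₀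
      (hself_mem y₀ hy₀)
    have hsum₁ := intervalIntegral.integral_add_adjacent_intervals hleft hright
    have hsum₂ := intervalIntegral.integral_add_adjacent_intervals
      ((hleft.trans hright).trans hmain.symm) hmain
    have hq := hint y₀ hy₀
    have hq₀ := hint 0 h0mem
    rw [h0] at hq₀
    rw [hslope_eq]
    simp only [hG]
    linarith
  have hlim : Tendsto (fun y₀ => (yR y₀ - yhat₁) / y₀ ^ 2) (𝓝[>] 0)
      (𝓝 (W yhat₁ / (2 * a ^ 2 * yhat₁))) := by
    have hquot := hHlim.div hslope hghat
    have hval : -1 / (2 * a ^ 2) / g yhat₁ = W yhat₁ / (2 * a ^ 2 * yhat₁) := by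
      have := hyhat₁.ne
      have := hWhat.ne'
      simp only [hg]
      field_simp
    rw [hval] at hquot
    refine hquot.congr' ?_
    filter_upwards [hIoo, hslope.eventually_ne hghat] with y hy hne
    rw [Pi.div_apply, ← hGH y (Ioo_subset_Ico_self hy)]
    have := hy.1.ne'
    field_simp
  refine ⟨hlim, ?_⟩
  have hid : Tendsto (fun y : ℝ => y) (𝓝[>] 0) (𝓝 0) := nhdsWithin_le_nhds
  have hprod := hlim.mul hid
  rw [mul_zero] at hprod
  refine hprod.congr' ?_
  filter_upwards [hIoo] with y hy
  have := hy.1.ne'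
  rw [h0]
  field_simp
end

section
/- Fix real numbers a, T, D with a < 0 and 4D − T² > 0, let W(y) = D·y² − a·T·y + a², and let λ > 0. Let ε > 0 and let yL : [λ, λ + ε) → ℝ be a function that is continuous at λ with yL(λ) = 0 and differentiable on (λ, λ + ε), such that for every y₀ ∈ (λ, λ + ε) one has yL(y₀) < 0 and W(y) > 0 for all y ∈ [yL(y₀), y₀], and such that ∫_{yL(y₀)}^{y₀} (−y)/W(y) dy = 2πT/(D·√(4D − T²)) for all y₀ ∈ [λ, λ + ε). Then the limit as y₀ → λ⁺ of yL(y₀)/√(y₀ − λ) exists and equals a·√(2λ/W(λ)). -/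
open Real

open Filter Topology in
/-- If `F` vanishes at `0` and has derivative `-y / W y` at every `y`, then `F y / y ^ 2`
tends to `-1 / (2 * W 0)` as `y → 0`. -/
theorem tendsto_div_sq_of_hasDerivAt_neg_div {F W : ℝ → ℝ} (hW : ContinuousAt W 0)
    (hW0 : W 0 ≠ 0) (hF0 : F 0 = 0) (hF : ∀ y, HasDerivAt F (-y / W y) y) :
    Tendsto (fun y => F y / y ^ 2) (𝓝[≠] 0) (𝓝 (-1 / (2 * W 0))) := by
  refine HasDerivAt.lhopital_zero_nhdsNE (f' := fun y => -y / W y) (g' := fun y => 2 * y)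
    (.of_forall hF) (.of_forall fun y => by simpa using hasDerivAt_pow 2 y) ?_ ?_ ?_ ?_
  · filter_upwards [self_mem_nhdsWithin] with y hy
    exact mul_ne_zero two_ne_zero hy
  · simpa [hF0] using (hF 0).continuousAt.tendsto.mono_left nhdsWithin_le_nhds
  · simpa using ((continuous_pow 2).tendsto (0 : ℝ)).mono_left nhdsWithin_le_nhds
  · have h : Tendsto (fun y => -1 / (2 * W y)) (𝓝[≠] 0) (𝓝 (-1 / (2 * W 0))) :=
      (tendsto_const_nhds.div (tendsto_const_nhds.mul hW.tendsto)
        (mul_ne_zero two_ne_zero hW0)).mono_left nhdsWithin_le_nhds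
    refine h.congr' ?_
    filter_upwards [self_mem_nhdsWithin] with y (hy : y ≠ 0)
    by_cases hy' : W y = 0
    · simp [hy']
    · field_simp

/-- Leading term of the Newton–Puiseux expansion of the forward Poincaré
half-map `yL` at a point `λ > 0` where it vanishes:
`yL y₀ / √(y₀ - λ) → a·√(2λ/W λ)` as `y₀ → λ⁺`. -/
theorem poincare_half_map_newton_puiseux
    (a T D : ℝ) (ha : a < 0) (hdisc : 0 < 4 * D - T ^ 2)
    (W : ℝ → ℝ) (hW : ∀ y, W y = D * y ^ 2 - a * T * y + a ^ 2)
    (lam : ℝ) (hlam : 0 < lam)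
    (ε : ℝ) (hε : 0 < ε)
    (yL : ℝ → ℝ)
    (hcont : ContinuousWithinAt yL (Set.Ici lam) lam)
    (h0 : yL lam = 0)
    (hdiff : ∀ y₀ ∈ Set.Ioo lam (lam + ε), DifferentiableAt ℝ yL y₀)
    (hneg : ∀ y₀ ∈ Set.Ioo lam (lam + ε), yL y₀ < 0)
    (hpos : ∀ y₀ ∈ Set.Ioo lam (lam + ε), ∀ y ∈ Set.Icc (yL y₀) y₀, 0 < W y)
    (hint : ∀ y₀ ∈ Set.Ico lam (lam + ε),
      ∫ y in yL y₀..y₀, (-y) / W y = 2 * π * T / (D * Real.sqrt (4 * D - T ^ 2))) :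
    Filter.Tendsto (fun y₀ => yL y₀ / Real.sqrt (y₀ - lam))
      (nhdsWithin lam (Set.Ioi lam))
      (nhds (a * Real.sqrt (2 * lam / W lam))) := by
  have hWpos : ∀ y, 0 < W y := by
    intro y
    have ha2 : 0 < a ^ 2 := sq_pos_of_neg ha
    have hD : 0 < D := by nlinarith [sq_nonneg T]
    rw [hW]
    have h : 0 < 4 * D * (D * y ^ 2 - a * T * y + a ^ 2) := by
      nlinarith [sq_nonneg (2 * D * y - a * T), mul_pos ha2 hdisc]
    exact pos_of_mul_pos_right h (by positivity)
  have hWc : Continuous W := by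
    rw [funext hW]
    fun_prop
  have hfc : Continuous fun y => -y / W y :=
    continuous_neg.div hWc fun y => (hWpos y).ne'
  have hii (u v : ℝ) : IntervalIntegrable (fun y => -y / W y) MeasureTheory.volume u v :=
    hfc.intervalIntegrable u v
  set F : ℝ → ℝ := fun x => ∫ y in (0 : ℝ)..x, -y / W y with hFdef
  have hF (x : ℝ) : HasDerivAt F (-x / W x) x :=
    intervalIntegral.integral_hasDerivAt_right (hii 0 x)
      hfc.stronglyMeasurable.stronglyMeasurableAtFilter hfc.continuousAt
  have hF0 : F 0 = 0 := intervalIntegral.integral_same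
  have hW0 : W 0 = a ^ 2 := by simp [hW]
  have hFeq : ∀ y ∈ Set.Ioo lam (lam + ε), F (yL y) = F y - F lam := by
    intro y hy
    have h1 := hint y ⟨hy.1.le, hy.2⟩
    have h2 := hint lam ⟨le_rfl, by linarith⟩
    rw [← intervalIntegral.integral_interval_sub_left (hii 0 y) (hii 0 (yL y))] at h1
    rw [h0] at h2
    simp only [hFdef]
    linarith
  have hmem : ∀ᶠ y in nhdsWithin lam (Set.Ioi lam), y ∈ Set.Ioo lam (lam + ε) :=
    Ioo_mem_nhdsGT (by linarith)
  have hyL : Filter.Tendsto yL (nhdsWithin lam (Set.Ioi lam)) (nhdsWithin 0 {0}ᶜ) := by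
    refine tendsto_nhdsWithin_iff.2 ⟨?_, hmem.mono fun y hy => (hneg y hy).ne⟩
    simpa [h0] using hcont.tendsto.mono_left (nhdsWithin_mono lam Set.Ioi_subset_Ici_self)
  have hne0 : -1 / (2 * W 0) ≠ 0 := by simp [(hWpos 0).ne']
  have hquad := (tendsto_div_sq_of_hasDerivAt_neg_div hWc.continuousAt (hWpos 0).ne' hF0 hF).comp
    hyL
  have hslope : Filter.Tendsto (slope F lam) (nhdsWithin lam (Set.Ioi lam)) (nhds (-lam / W lam)) :=
    (hasDerivAt_iff_tendsto_slope.1 (hF lam)).mono_left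
      (nhdsWithin_mono lam fun y hy => (Set.mem_Ioi.1 hy).ne')
  have hsq : Filter.Tendsto (fun y => yL y ^ 2 / (y - lam)) (nhdsWithin lam (Set.Ioi lam))
      (nhds (-lam / W lam / (-1 / (2 * W 0)))) := by
    refine (hslope.div hquad hne0).congr' ?_
    filter_upwards [hmem, hquad.eventually_ne hne0] with y hy hne
    have hy0 : yL y ≠ 0 := (hneg y hy).ne
    have hsub : y - lam ≠ 0 := (sub_pos.2 hy.1).ne'
    have hFne : F (yL y) ≠ 0 := fun h => hne (by simp [h])
    simp only [Pi.div_apply, Function.comp_apply, slope_def_field, ← hFeq y hy]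
    field_simp
  have hlim : a * √(2 * lam / W lam) = -√(-lam / W lam / (-1 / (2 * W 0))) := by
    have h : -lam / W lam / (-1 / (2 * W 0)) = a ^ 2 * (2 * lam / W lam) := by
      have := (hWpos lam).ne'
      rw [hW0]
      field_simp
    rw [h, Real.sqrt_mul (sq_nonneg a), Real.sqrt_sq_eq_abs, abs_of_neg ha, neg_mul, neg_neg]
  rw [hlim]
  refine hsq.sqrt.neg.congr' ?_
  filter_upwards [hmem] with y hy
  rw [Real.sqrt_div (sq_nonneg _), Real.sqrt_sq_eq_abs, abs_of_neg (hneg y hy), neg_div, neg_neg]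
end

section
/- Let (a_L, T_L, D_L) and (a_R, T_R, D_R) be real parameters with a_L ≠ 0 and a_R ≠ 0; define W_L(y) = D_L·y² − a_L·T_L·y + a_L², W_R(y) = D_R·y² − a_R·T_R·y + a_R², c₀ = a_R·a_L·(a_R·T_L − a_L·T_R), c₁ = a_R·T_R·D_L − a_L·T_L·D_R, c₂ = a_L²·D_R − a_R²·D_L, and F(u, v) = c₀ + c₁·u·v + c₂·(u + v). Let y₀* > 0 > y₁*, assume W_L(y) > 0 and W_R(y) > 0 for all y ∈ [y₁*, y₀*], and let yL and yR be differentiable functions on an open interval I containing y₀*, with values in (−∞, 0], such that yL(y₀*) = yR(y₀*) = y₁*, such that for all y₀ ∈ I the integrals ∫_{yL(y₀)}^{y₀} (−y)/W_L(y) dy and ∫_{yR(y₀)}^{y₀} (−y)/W_R(y) dy are each constant in y₀, and such that W_L(y), W_R(y) > 0 on [yL(y₀), y₀] and [yR(y₀), y₀] respectively for all y₀ ∈ I. Then sign(yR′(y₀*) − yL′(y₀*)) = sign(F(y₀*, y₁*)). -/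
/-- Implicit differentiation of a constant integral with variable limits: if
`∫ y in g x..x, -y / W y` is locally constant near `x₀`, then `g' x₀` is determined. -/
theorem deriv_lower_limit_of_integral_eventually_const
    {W g : ℝ → ℝ} {x₀ q : ℝ} (hW : Continuous W) (hle : g x₀ ≤ x₀) (hg₀ : g x₀ ≠ 0)
    (hpos : ∀ y ∈ Set.Icc (g x₀) x₀, 0 < W y) (hg : DifferentiableAt ℝ g x₀)
    (hq : ∀ᶠ x in nhds x₀, ∫ y in g x..x, (-y) / W y = q) :
    deriv g x₀ = x₀ * W (g x₀) / (g x₀ * W x₀) := by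
  have hWl := hpos _ (Set.left_mem_Icc.2 hle)
  have hWr := hpos _ (Set.right_mem_Icc.2 hle)
  have hmeas : Measurable fun y => (-y) / W y := measurable_neg.div hW.measurable
  have hcont : ∀ y, 0 < W y → ContinuousAt (fun y => (-y) / W y) y := fun y hy =>
    continuousAt_neg.div hW.continuousAt hy.ne'
  have hint : IntervalIntegrable (fun y => (-y) / W y) MeasureTheory.volume (g x₀) x₀ := by
    refine ContinuousOn.intervalIntegrable fun y hy => (hcont y (hpos y ?_)).continuousWithinAt
    rwa [Set.uIcc_of_le hle] at hy
  have hF := intervalIntegral.integral_hasFDerivAt hint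
    hmeas.stronglyMeasurable.stronglyMeasurableAtFilter
    hmeas.stronglyMeasurable.stronglyMeasurableAtFilter (hcont _ hWl) (hcont _ hWr)
  have hcomp := HasFDerivAt.comp_hasDerivAt (f := fun x => (g x, x)) x₀ hF
    (hg.hasDerivAt.prodMk (hasDerivAt_id x₀))
  have hconst := (hasDerivAt_const x₀ q).congr_of_eventuallyEq hq
  have h := hcomp.unique hconst
  simp only [ContinuousLinearMap.sub_apply, ContinuousLinearMap.smulRight_apply,
    ContinuousLinearMap.coe_fst', ContinuousLinearMap.coe_snd', smul_eq_mul, one_mul] at h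
  field_simp at h ⊢
  linarith

/-- Sign of the derivative of the displacement function `δ₀ = yR - yL` at a
zero `y₀*` (with `yL y₀* = yR y₀* = y₁* < 0 < y₀*`):
`sign (yR' y₀* - yL' y₀*) = sign (F y₀* y₁*)`, where
`F(u, v) = c₀ + c₁ u v + c₂ (u + v)`. -/
theorem sign_displacement_derivative
    (aL TL DL aR TR DR : ℝ) (haL : aL ≠ 0) (haR : aR ≠ 0)
    (WL WR : ℝ → ℝ)
    (hWL : ∀ y, WL y = DL * y ^ 2 - aL * TL * y + aL ^ 2)
    (hWR : ∀ y, WR y = DR * y ^ 2 - aR * TR * y + aR ^ 2)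
    (c₀ c₁ c₂ : ℝ)
    (hc₀ : c₀ = aR * aL * (aR * TL - aL * TR))
    (hc₁ : c₁ = aR * TR * DL - aL * TL * DR)
    (hc₂ : c₂ = aL ^ 2 * DR - aR ^ 2 * DL)
    (F : ℝ → ℝ → ℝ)
    (hF : ∀ u v, F u v = c₀ + c₁ * u * v + c₂ * (u + v))
    (y₀s y₁s : ℝ) (hy₀s : 0 < y₀s) (hy₁s : y₁s < 0)
    (hWLpos : ∀ y ∈ Set.Icc y₁s y₀s, 0 < WL y)
    (hWRpos : ∀ y ∈ Set.Icc y₁s y₀s, 0 < WR y)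
    (lo hi : ℝ) (hmem : y₀s ∈ Set.Ioo lo hi)
    (yL yR : ℝ → ℝ)
    (hdiffL : ∀ y₀ ∈ Set.Ioo lo hi, DifferentiableAt ℝ yL y₀)
    (hdiffR : ∀ y₀ ∈ Set.Ioo lo hi, DifferentiableAt ℝ yR y₀)
    (hnegL : ∀ y₀ ∈ Set.Ioo lo hi, yL y₀ ≤ 0)
    (hnegR : ∀ y₀ ∈ Set.Ioo lo hi, yR y₀ ≤ 0)
    (heqL : yL y₀s = y₁s) (heqR : yR y₀s = y₁s)
    (qL qR : ℝ)
    (hintL : ∀ y₀ ∈ Set.Ioo lo hi, ∫ y in yL y₀..y₀, (-y) / WL y = qL)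
    (hintR : ∀ y₀ ∈ Set.Ioo lo hi, ∫ y in yR y₀..y₀, (-y) / WR y = qR)
    (hposL : ∀ y₀ ∈ Set.Ioo lo hi, ∀ y ∈ Set.Icc (yL y₀) y₀, 0 < WL y)
    (hposR : ∀ y₀ ∈ Set.Ioo lo hi, ∀ y ∈ Set.Icc (yR y₀) y₀, 0 < WR y) :
    Real.sign (deriv yR y₀s - deriv yL y₀s) = Real.sign (F y₀s y₁s) := by
  have hlt : y₁s < y₀s := hy₁s.trans hy₀s
  have hI : ∀ᶠ x in nhds y₀s, x ∈ Set.Ioo lo hi := Ioo_mem_nhds hmem.1 hmem.2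
  have hL := deriv_lower_limit_of_integral_eventually_const (W := WL) (g := yL) (x₀ := y₀s)
    (by rw [funext hWL]; fun_prop) (heqL ▸ hlt.le) (heqL ▸ hy₁s.ne)
    (hposL _ hmem) (hdiffL _ hmem) (hI.mono hintL)
  have hR := deriv_lower_limit_of_integral_eventually_const (W := WR) (g := yR) (x₀ := y₀s)
    (by rw [funext hWR]; fun_prop) (heqR ▸ hlt.le) (heqR ▸ hy₁s.ne)
    (hposR _ hmem) (hdiffR _ hmem) (hI.mono hintR)
  rw [heqL] at hL
  rw [heqR] at hR
  have hL₀ := hWLpos _ (Set.right_mem_Icc.2 hlt.le)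
  have hR₀ := hWRpos _ (Set.right_mem_Icc.2 hlt.le)
  have hcross : WR y₁s * WL y₀s - WL y₁s * WR y₀s = (y₁s - y₀s) * F y₀s y₁s := by
    rw [hWL, hWL, hWR, hWR, hF, hc₀, hc₁, hc₂]
    ring
  have hfactor : deriv yR y₀s - deriv yL y₀s =
      y₀s * (y₁s - y₀s) / (y₁s * (WR y₀s * WL y₀s)) * F y₀s y₁s := by
    have hdiff : deriv yR y₀s - deriv yL y₀s =
        y₀s * (WR y₁s * WL y₀s - WL y₁s * WR y₀s) / (y₁s * (WR y₀s * WL y₀s)) := by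
      rw [hL, hR]
      have := hy₁s.ne
      field_simp
    rw [hdiff, hcross]
    ring
  have hk : 0 < y₀s * (y₁s - y₀s) / (y₁s * (WR y₀s * WL y₀s)) :=
    div_pos_of_neg_of_neg (mul_neg_of_pos_of_neg hy₀s (sub_neg.2 hlt))
      (mul_neg_of_neg_of_pos hy₁s (mul_pos hR₀ hL₀))
  rw [hfactor]
  rcases lt_trichotomy (F y₀s y₁s) 0 with h | h | h
  · rw [Real.sign_of_neg h, Real.sign_of_neg (mul_neg_of_pos_of_neg hk h)]
  · rw [h, mul_zero]
  · rw [Real.sign_of_pos h, Real.sign_of_pos (mul_pos hk h)]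
end

section
/- Let (a_L, T_L, D_L) and (a_R, T_R, D_R) be real parameters with a_L < 0, 4·D_L − T_L² > 0, a_R > 0, and 4·D_R − T_R² > 0, and let W_L(y) = D_L·y² − a_L·T_L·y + a_L² and W_R(y) = D_R·y² − a_R·T_R·y + a_R². Suppose there exist y₁ < 0 < y₀ with W_L(y) > 0 and W_R(y) > 0 for all y ∈ [y₁, y₀], such that ∫_{y₁}^{y₀} (−y)/W_L(y) dy = 2πT_L/(D_L·√(4D_L − T_L²)) and ∫_{y₁}^{y₀} (−y)/W_R(y) dy = −2πT_R/(D_R·√(4D_R − T_R²)). Then sign(T_R) = −sign(T_L). -/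
open Real

/-- A primitive of `-y / (D y² + e t y + e²)` when the quadratic has negative discriminant. -/
theorem hasDerivAt_focus_primitive {D e t : ℝ} (he : 0 < e) (hd : 0 < 4 * D - t ^ 2) (y : ℝ) :
    HasDerivAt (fun y => -(1 / (2 * D)) * log (D * y ^ 2 + e * t * y + e ^ 2) +
        t / (D * √(4 * D - t ^ 2)) * arctan ((2 * D * y + e * t) / (e * √(4 * D - t ^ 2))))
      (-y / (D * y ^ 2 + e * t * y + e ^ 2)) y := by
  have hD : 0 < D := by nlinarith [sq_nonneg t]
  have hW : 0 < D * y ^ 2 + e * t * y + e ^ 2 := by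
    have h : 0 < (2 * D * y + e * t) ^ 2 + e ^ 2 * (4 * D - t ^ 2) := by positivity
    nlinarith
  have hs : 0 < √(4 * D - t ^ 2) := Real.sqrt_pos.2 hd
  have hs2 : √(4 * D - t ^ 2) ^ 2 = 4 * D - t ^ 2 := Real.sq_sqrt hd.le
  generalize √(4 * D - t ^ 2) = s at hs hs2 ⊢
  have hquad : HasDerivAt (fun y => D * y ^ 2 + e * t * y + e ^ 2) (2 * D * y + e * t) y := by
    refine ((((hasDerivAt_pow 2 y).const_mul D).add
      ((hasDerivAt_id y).const_mul (e * t))).add_const (e ^ 2)).congr_deriv ?_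
    norm_num
    ring
  have hlin : HasDerivAt (fun y => (2 * D * y + e * t) / (e * s)) (2 * D / (e * s)) y := by
    simpa using (((hasDerivAt_id y).const_mul (2 * D)).add_const (e * t)).div_const (e * s)
  have harctan : 1 + ((2 * D * y + e * t) / (e * s)) ^ 2 =
      4 * D * (D * y ^ 2 + e * t * y + e ^ 2) / (e * s) ^ 2 := by
    field_simp
    rw [hs2]
    ring
  refine (((hquad.log hW.ne').const_mul (-(1 / (2 * D)))).add
    (hlin.arctan.const_mul (t / (D * s)))).congr_deriv ?_
  rw [harctan]
  field_simp
  ring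

/-- The integral condition for a half-map around a focus forces the sum of the crossing ordinates
to have sign opposite to `t`. -/
theorem sign_add_of_integral_eq {D e t y₀ y₁ : ℝ} (he : 0 < e) (hd : 0 < 4 * D - t ^ 2)
    (hlt : y₁ < y₀)
    (hint : ∫ y in y₁..y₀, -y / (D * y ^ 2 + e * t * y + e ^ 2) =
      2 * π * t / (D * √(4 * D - t ^ 2))) :
    Real.sign (y₀ + y₁) = -Real.sign t := by
  have hD : 0 < D := by nlinarith [sq_nonneg t]
  have hW (y : ℝ) : 0 < D * y ^ 2 + e * t * y + e ^ 2 := by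
    have h : 0 < (2 * D * y + e * t) ^ 2 + e ^ 2 * (4 * D - t ^ 2) := by positivity
    nlinarith
  have hs : 0 < √(4 * D - t ^ 2) := Real.sqrt_pos.2 hd
  have hcont : Continuous fun y => -y / (D * y ^ 2 + e * t * y + e ^ 2) :=
    continuous_neg.div (by fun_prop) fun y => (hW y).ne'
  rw [intervalIntegral.integral_eq_sub_of_hasDerivAt
    (fun y _ => hasDerivAt_focus_primitive he hd y) (hcont.intervalIntegrable _ _)] at hint
  generalize √(4 * D - t ^ 2) = s at hs hint
  have hΔ : arctan ((2 * D * y₀ + e * t) / (e * s)) - arctan ((2 * D * y₁ + e * t) / (e * s)) -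
      2 * π < 0 := by
    linarith [arctan_lt_pi_div_two ((2 * D * y₀ + e * t) / (e * s)),
      neg_pi_div_two_lt_arctan ((2 * D * y₁ + e * t) / (e * s)), pi_pos]
  generalize arctan ((2 * D * y₀ + e * t) / (e * s)) = α at hint hΔ
  generalize arctan ((2 * D * y₁ + e * t) / (e * s)) = β at hint hΔ
  have hlog : log (D * y₀ ^ 2 + e * t * y₀ + e ^ 2) - log (D * y₁ ^ 2 + e * t * y₁ + e ^ 2) =
      2 * t / s * (α - β - 2 * π) := by
    field_simp at hint ⊢
    linarith
  rcases lt_trichotomy t 0 with ht | rfl | ht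
  · have hlt' := (log_lt_log_iff (hW y₁) (hW y₀)).1 <| sub_pos.1 <| hlog ▸
      mul_pos_of_neg_of_neg (div_neg_of_neg_of_pos (by linarith) hs) hΔ
    have hprod : 0 < (y₀ - y₁) * (D * (y₀ + y₁) + e * t) := by linarith
    have hfac := pos_of_mul_pos_right hprod (sub_pos.2 hlt).le
    have het := mul_neg_of_pos_of_neg he ht
    rw [sign_of_neg ht, sign_of_pos (pos_of_mul_pos_right (by linarith) hD.le), neg_neg]
  · have heq := log_injOn_pos (hW y₀) (hW y₁)
      (by linarith [show 2 * 0 / s * (α - β - 2 * π) = 0 by simp])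
    have hprod : (D * (y₀ - y₁)) * (y₀ + y₁) = 0 := by linarith
    rw [(mul_eq_zero.1 hprod).resolve_left (mul_pos hD (sub_pos.2 hlt)).ne']
    simp
  · have hlt' := (log_lt_log_iff (hW y₀) (hW y₁)).1 <| sub_neg.1 <| hlog ▸
      mul_neg_of_pos_of_neg (div_pos (by linarith) hs) hΔ
    have hprod : (y₀ - y₁) * (D * (y₀ + y₁) + e * t) < 0 := by linarith
    have hfac := neg_of_mul_neg_right hprod (sub_pos.2 hlt).le
    have het := mul_pos he ht
    rw [sign_of_pos ht, sign_of_neg (neg_of_mul_neg_right (by linarith) hD.le)]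

/-- If a crossing periodic orbit exists, i.e. there are `y₁ < 0 < y₀`
satisfying both integral characterizations of the forward and backward
Poincaré half-maps, then `sign T_R = - sign T_L`. -/
theorem trace_balance_of_crossing_periodic_orbit
    (aL TL DL aR TR DR : ℝ)
    (haL : aL < 0) (hdL : 0 < 4 * DL - TL ^ 2)
    (haR : 0 < aR) (hdR : 0 < 4 * DR - TR ^ 2)
    (WL WR : ℝ → ℝ)
    (hWL : ∀ y, WL y = DL * y ^ 2 - aL * TL * y + aL ^ 2)
    (hWR : ∀ y, WR y = DR * y ^ 2 - aR * TR * y + aR ^ 2)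
    (y₁ y₀ : ℝ) (hy₁ : y₁ < 0) (hy₀ : 0 < y₀)
    (hposL : ∀ y ∈ Set.Icc y₁ y₀, 0 < WL y)
    (hposR : ∀ y ∈ Set.Icc y₁ y₀, 0 < WR y)
    (hintL : ∫ y in y₁..y₀, (-y) / WL y =
      2 * π * TL / (DL * Real.sqrt (4 * DL - TL ^ 2)))
    (hintR : ∫ y in y₁..y₀, (-y) / WR y =
      -(2 * π * TR) / (DR * Real.sqrt (4 * DR - TR ^ 2))) :
    Real.sign TR = -Real.sign TL := by
  have hL : Real.sign (y₀ + y₁) = -Real.sign TL := by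
    refine sign_add_of_integral_eq (e := -aL) (neg_pos.2 haL) hdL (hy₁.trans hy₀) ?_
    simpa [hWL, sub_eq_add_neg] using hintL
  have hR : Real.sign (y₀ + y₁) = -Real.sign (-TR) := by
    refine sign_add_of_integral_eq haR (by rwa [neg_sq]) (hy₁.trans hy₀) ?_
    simpa [hWR, sub_eq_add_neg] using hintR
  rw [← hL, hR, Real.sign_neg, neg_neg]
end

section
/- Let (a_L, T_L, D_L) and (a_R, T_R, D_R) be real parameters with T_L·T_R < 0, a_L < 0, 4·D_R − T_R² > 0, a_R·T_L − a_L·T_R = 0, and T_L²·D_R − T_R²·D_L = 0. Define W_L(y) = D_L·y² − a_L·T_L·y + a_L² and W_R(y) = D_R·y² − a_R·T_R·y + a_R². Then a_R > 0, 4·D_L − T_L² > 0, and for all real numbers y₁ ≤ 0 ≤ y₀ with W_R(y) > 0 on [y₁, y₀], the equality ∫_{y₁}^{y₀} (−y)/W_L(y) dy = 2πT_L/(D_L·√(4D_L − T_L²)) holds if and only if ∫_{y₁}^{y₀} (−y)/W_R(y) dy = −2πT_R/(D_R·√(4D_R − T_R²)). -/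
open Real

/-- Under `T_L·T_R < 0`, `a_L < 0`, `4D_R - T_R² > 0`, `xi₀ = 0`, and `xiInf = 0`,
one has `a_R > 0`, `4D_L - T_L² > 0`, and the integral characterizations of
the forward and backward Poincaré half-maps coincide. -/
theorem integral_characterizations_coincide
    (aL TL DL aR TR DR : ℝ)
    (hT : TL * TR < 0)
    (haL : aL < 0) (hdR : 0 < 4 * DR - TR ^ 2)
    (hxi₀ : aR * TL - aL * TR = 0)
    (hxiInf : TL ^ 2 * DR - TR ^ 2 * DL = 0)
    (WL WR : ℝ → ℝ)
    (hWL : ∀ y, WL y = DL * y ^ 2 - aL * TL * y + aL ^ 2)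
    (hWR : ∀ y, WR y = DR * y ^ 2 - aR * TR * y + aR ^ 2) :
    0 < aR ∧ 0 < 4 * DL - TL ^ 2 ∧
      ∀ y₁ y₀ : ℝ, y₁ ≤ 0 → 0 ≤ y₀ → (∀ y ∈ Set.Icc y₁ y₀, 0 < WR y) →
        ((∫ y in y₁..y₀, (-y) / WL y =
            2 * π * TL / (DL * Real.sqrt (4 * DL - TL ^ 2))) ↔
          ∫ y in y₁..y₀, (-y) / WR y =
            -(2 * π * TR) / (DR * Real.sqrt (4 * DR - TR ^ 2))) := by
  have hTR : TR ≠ 0 := by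
    rintro rfl
    simp at hT
  obtain ⟨k, rfl⟩ : ∃ k, TL = k * TR := ⟨TL / TR, by field_simp⟩
  have hk : k < 0 := by
    have := sq_nonneg TR
    by_contra! h
    nlinarith [mul_nonneg h this]
  obtain rfl : aL = k * aR :=
    mul_right_cancel₀ hTR (by linear_combination -hxi₀)
  obtain rfl : DL = k ^ 2 * DR :=
    mul_right_cancel₀ (pow_ne_zero 2 hTR) (by linear_combination -hxiInf)
  have haR : 0 < aR := pos_of_mul_neg_right haL hk.le
  have hk2 : 0 < k ^ 2 := sq_pos_of_neg hk
  have hdisc : 4 * (k ^ 2 * DR) - (k * TR) ^ 2 = k ^ 2 * (4 * DR - TR ^ 2) := by ring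
  have hDR : 0 < DR := by nlinarith [sq_nonneg TR]
  have hsqrt : 0 < Real.sqrt (4 * DR - TR ^ 2) := Real.sqrt_pos.mpr hdR
  refine ⟨haR, hdisc ▸ mul_pos hk2 hdR, fun y₁ y₀ _ _ _ => ?_⟩
  have hint : ∫ y in y₁..y₀, (-y) / WL y = (k ^ 2)⁻¹ * ∫ y in y₁..y₀, (-y) / WR y := by
    rw [← intervalIntegral.integral_const_mul]
    congr 1
    funext y
    rw [show WL y = k ^ 2 * WR y by rw [hWL, hWR]; ring, div_mul_eq_div_div_swap]
    ring
  have hrhs : 2 * π * (k * TR) / (k ^ 2 * DR * Real.sqrt (4 * (k ^ 2 * DR) - (k * TR) ^ 2)) =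
      (k ^ 2)⁻¹ * (-(2 * π * TR) / (DR * Real.sqrt (4 * DR - TR ^ 2))) := by
    rw [hdisc, Real.sqrt_mul hk2.le, Real.sqrt_sq_eq_abs, abs_of_neg hk]
    have := hk.ne
    field_simp
  rw [hint, hrhs]
  exact mul_right_inj' (inv_ne_zero hk2.ne')
end
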